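/- Let m ≥ 1 and n ≥ 1 be integers, and let x, y be distinct real algebraic numbers of degree exactly m lying in [0, 1/2] with H(x) ≤ n and H(y) ≤ n. Then |cos(πx) − cos(πy)| ≥ π / (2^{4m²+1} · n^{2m+1}). -/

import Mathlib

open Polynomial

/-- The primitive minimal polynomial over ℤ of a real number. -/
noncomputable def intMinpoly (α : ℝ) : Polynomial ℤ :=
  (IsLocalization.integerNormalization (nonZeroDivisors ℤ) (minpoly ℚ α)).primPart

/-- The height of an algebraic number: the maximum of the absolute values of the
coefficients of its primitive minimal polynomial over ℤ. -/
noncomputable def algHeight (α : ℝ) : ℕ :=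
  (intMinpoly α).support.sup fun i => ((intMinpoly α).coeff i).natAbs

/-- `α` is a real algebraic number of degree exactly `m`. -/
def DegreeExactly (m : ℕ) (α : ℝ) : Prop :=
  IsAlgebraic ℚ α ∧ (minpoly ℚ α).natDegree = m

/-- `exp^[3](x) = e^(e^(e^x))`. -/
noncomputable def expCube (x : ℝ) : ℝ := Real.exp (Real.exp (Real.exp x))

/-- `ξ` is an `m`-ultra number: there is a sequence `(α_n)_{n ≥ 1}` of pairwise distinct
real algebraic numbers of degree exactly `m` with
`0 < |ξ - α_n| < (exp^[3](H(α_n)))^{-n}` for all `n ≥ 1`. Here `a k` plays the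
role of `α_{k+1}`. -/
def IsMUltra (m : ℕ) (ξ : ℝ) : Prop :=
  ∃ a : ℕ → ℝ, Function.Injective a ∧
    ∀ n : ℕ, DegreeExactly m (a n) ∧ 0 < |ξ - a n| ∧
      |ξ - a n| < (expCube (algHeight (a n)))⁻¹ ^ (n + 1)

/-- A function `f : ℝ → ℝ` is transcendental if the only complex two-variable polynomial
`P` with `P (x, f x) = 0` for all real `x` is the zero polynomial. -/
def TranscendentalFun (f : ℝ → ℝ) : Prop :=
  ∀ P : MvPolynomial (Fin 2) ℂ,
    (∀ x : ℝ, MvPolynomial.eval ![(x : ℂ), (f x : ℂ)] P = 0) → P = 0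

lemma intMinpoly_map {α : ℝ} (hα : IsAlgebraic ℚ α) :
    ∃ c : ℚ, c ≠ 0 ∧ (intMinpoly α).map (algebraMap ℤ ℚ) = C c * minpoly ℚ α := by
  have h0 : minpoly ℚ α ≠ 0 := minpoly.ne_zero hα.isIntegral
  obtain ⟨b, hb, hbe⟩ :=
    IsLocalization.integerNormalization_spec (nonZeroDivisors ℤ) (minpoly ℚ α)
  have hN : IsLocalization.integerNormalization (nonZeroDivisors ℤ) (minpoly ℚ α) ≠ 0 := by
    rwa [Ne, IsFractionRing.integerNormalization_eq_zero_iff]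
  have hb0 : (b : ℚ) ≠ 0 := by exact_mod_cast nonZeroDivisors.ne_zero hb
  set N := IsLocalization.integerNormalization (nonZeroDivisors ℤ) (minpoly ℚ α) with hNdef
  have hk : (N.content : ℚ) ≠ 0 := by
    exact_mod_cast mt content_eq_zero_iff.mp hN
  have hmul : C (N.content : ℚ) * (intMinpoly α).map (algebraMap ℤ ℚ) =
      C (b : ℚ) * minpoly ℚ α := by
    have := congrArg (Polynomial.map (algebraMap ℤ ℚ)) N.eq_C_content_mul_primPart
    rw [hbe, Polynomial.map_mul] at this
    rw [intMinpoly, ← hNdef]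
    rw [map_C, algebraMap_int_eq, eq_intCast, zsmul_eq_mul, ← C_eq_intCast] at this
    exact this.symm
  refine ⟨(N.content : ℚ)⁻¹ * b, mul_ne_zero (inv_ne_zero hk) hb0, ?_⟩
  rw [C_mul, mul_assoc, ← hmul, ← mul_assoc, ← C_mul, inv_mul_cancel₀ hk, C_1, one_mul]

lemma natDegree_intMinpoly {α : ℝ} (hα : IsAlgebraic ℚ α) :
    (intMinpoly α).natDegree = (minpoly ℚ α).natDegree := by
  obtain ⟨c, hc, h⟩ := intMinpoly_map hα
  rw [← natDegree_C_mul (p := minpoly ℚ α) hc, ← h,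
    natDegree_map_eq_of_injective (algebraMap ℤ ℚ).injective_int]

lemma intMinpoly_ne_zero {α : ℝ} (hα : IsAlgebraic ℚ α) : intMinpoly α ≠ 0 := by
  obtain ⟨c, hc, h⟩ := intMinpoly_map hα
  intro h0
  rw [h0, Polynomial.map_zero] at h
  exact mul_ne_zero (C_ne_zero.mpr hc) (minpoly.ne_zero hα.isIntegral) h.symm

lemma aeval_intMinpoly_eq_zero_iff {α : ℝ} (hα : IsAlgebraic ℚ α) {A : Type*} [CommRing A]
    [IsDomain A] [Algebra ℚ A] (z : A) :
    aeval z (intMinpoly α) = 0 ↔ aeval z (minpoly ℚ α) = 0 := by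
  obtain ⟨c, hc, h⟩ := intMinpoly_map hα
  rw [← aeval_map_algebraMap ℚ z (intMinpoly α), h, map_mul, aeval_C, mul_eq_zero,
    map_eq_zero_iff _ (algebraMap ℚ A).injective]
  simp [hc]

lemma aeval_intMinpoly_self {α : ℝ} (hα : IsAlgebraic ℚ α) : aeval α (intMinpoly α) = 0 :=
  (aeval_intMinpoly_eq_zero_iff hα α).mpr (minpoly.aeval ℚ α)

lemma abs_coeff_intMinpoly_le (α : ℝ) (i : ℕ) :
    |((intMinpoly α).coeff i : ℝ)| ≤ algHeight α := by
  by_cases hi : i ∈ (intMinpoly α).support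
  · have : ((intMinpoly α).coeff i).natAbs ≤ algHeight α :=
      Finset.le_sup (f := fun i => ((intMinpoly α).coeff i).natAbs) hi
    rw [← Int.cast_abs, Int.abs_eq_natAbs]
    exact_mod_cast this
  · simp [notMem_support_iff.mp hi]

/-- An integer polynomial sharing a complex root with `intMinpoly α` is divisible by the
minimal polynomial of `α`. -/
lemma minpoly_dvd_map_of_common_root {α : ℝ} (hα : IsAlgebraic ℚ α) {R : ℤ[X]} {z : ℂ}
    (hz : aeval z (intMinpoly α) = 0) (hR : aeval z R = 0) :
    minpoly ℚ α ∣ R.map (algebraMap ℤ ℚ) := by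
  rw [aeval_intMinpoly_eq_zero_iff hα] at hz
  rw [minpoly.eq_of_irreducible_of_monic (minpoly.irreducible hα.isIntegral) hz
    (minpoly.monic hα.isIntegral)]
  exact minpoly.dvd ℚ z (by rwa [aeval_map_algebraMap])

lemma norm_aeval_le {R : ℤ[X]} {m : ℕ} {h : ℝ} (hR : R.natDegree ≤ m)
    (hc : ∀ i, |(R.coeff i : ℝ)| ≤ h) (z : ℂ) :
    ‖aeval z R‖ ≤ (m + 1) * h * max 1 ‖z‖ ^ m := by
  have h0 : 0 ≤ h := (abs_nonneg _).trans (hc 0)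
  rw [aeval_eq_sum_range' (Nat.lt_succ_of_le hR)]
  calc _ ≤ ∑ i ∈ Finset.range (m + 1), h * max 1 ‖z‖ ^ m := by
        refine norm_sum_le_of_le _ fun i hi => ?_
        rw [zsmul_eq_mul, norm_mul, Complex.norm_intCast, norm_pow]
        have hi' : i ≤ m := Nat.lt_succ_iff.mp (Finset.mem_range.mp hi)
        gcongr
        · exact hc i
        · exact (pow_le_pow_left₀ (norm_nonneg _) (le_max_right _ _) i).trans
            (pow_le_pow_right₀ (le_max_left _ _) hi')
    _ = _ := by simp [mul_assoc]

lemma mahlerMeasure_map_le {P : ℤ[X]} {m : ℕ} {n : ℝ} (hP : P.natDegree = m)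
    (hc : ∀ i, |(P.coeff i : ℝ)| ≤ n) :
    (P.map (algebraMap ℤ ℂ)).mahlerMeasure ≤ (m + 1) * n := by
  refine (mahlerMeasure_le_sum_norm_coeff _).trans ?_
  rw [sum_over_range' _ (by simp) (m + 1)
    (Nat.lt_succ_of_le (natDegree_map_le.trans hP.le))]
  calc _ ≤ ∑ i ∈ Finset.range (m + 1), n := by
        refine Finset.sum_le_sum fun i _ => ?_
        rw [coeff_map, eq_intCast, Complex.norm_intCast]
        exact hc i
    _ = _ := by simp

/-- Lower bound for the value of an integer polynomial `R` at a root `x` of an integer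
polynomial `P` having no complex root in common with `R`. -/
lemma one_le_abs_aeval_mul {P R : ℤ[X]} {m : ℕ} {n h x : ℝ} (hP0 : P ≠ 0)
    (hP : P.natDegree = m) (hR : R.natDegree ≤ m) (hcP : ∀ i, |(P.coeff i : ℝ)| ≤ n)
    (hcR : ∀ i, |(R.coeff i : ℝ)| ≤ h) (hx : aeval x P = 0)
    (hPR : ∀ z : ℂ, aeval z P = 0 → aeval z R ≠ 0) :
    1 ≤ |aeval x R| * ((m + 1) * h) ^ (m - 1) * ((m + 1) * n) ^ m := by
  have h0 : 0 ≤ h := (abs_nonneg _).trans (hcR 0)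
  have hinj : Function.Injective (algebraMap ℤ ℂ) := (algebraMap ℤ ℂ).injective_int
  set p := P.map (algebraMap ℤ ℂ) with hp
  have hp0 : p ≠ 0 := (Polynomial.map_ne_zero_iff hinj).mpr hP0
  have hpdeg : p.natDegree = m := (natDegree_map_eq_of_injective hinj P).trans hP
  have hsplit : p.Splits := IsAlgClosed.splits p
  have hxmem : (x : ℂ) ∈ p.roots := by
    rw [mem_roots hp0, IsRoot, hp, eval_map_algebraMap]
    have := aeval_algebraMap_apply ℂ x P
    rw [hx] at this
    simpa using this
  obtain ⟨t, ht⟩ := Multiset.exists_cons_of_mem hxmem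
  have hcard : Multiset.card t = m - 1 := by
    have := hsplit.natDegree_eq_card_roots
    rw [ht, Multiset.card_cons, hpdeg] at this
    omega
  have hres : ((resultant P R m m : ℤ) : ℂ) =
      p.leadingCoeff ^ m * (p.roots.map fun z => aeval z R).prod := by
    have := resultant_eq_prod_eval p (R.map (algebraMap ℤ ℂ)) m (natDegree_map_le.trans hR) hsplit
    rw [hpdeg, hp, resultant_map_map] at this
    simpa only [eval_map_algebraMap, eq_intCast] using this
  have hres0 : resultant P R m m ≠ 0 := by
    intro hzero
    rw [hzero, Int.cast_zero] at hres
    rcases mul_eq_zero.mp hres.symm with h1 | h1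
    · exact hp0 (leadingCoeff_eq_zero.mp (eq_zero_of_pow_eq_zero h1))
    · obtain ⟨z, hz, hz0⟩ := Multiset.mem_map.mp (Multiset.prod_eq_zero_iff.mp h1)
      refine hPR z ?_ hz0
      rwa [mem_roots hp0, IsRoot, hp, eval_map_algebraMap] at hz
  have hone : (1 : ℝ) ≤ ‖((resultant P R m m : ℤ) : ℂ)‖ := by
    rw [Complex.norm_intCast]
    exact_mod_cast Int.one_le_abs hres0
  have hxR : ‖aeval (x : ℂ) R‖ = |aeval x R| := by
    rw [← Real.norm_eq_abs, ← Complex.norm_real]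
    exact congrArg _ (aeval_algebraMap_apply ℂ x R)
  have hprod : ‖(t.map fun z => aeval z R).prod‖ ≤
      ((m + 1) * h) ^ (m - 1) * (t.map fun z => max 1 ‖z‖).prod ^ m := by
    rw [← hcard]
    clear hcard ht
    induction t using Multiset.induction_on with
    | empty => simp
    | cons z t ih =>
      simp only [Multiset.map_cons, Multiset.prod_cons, Multiset.card_cons, norm_mul]
      calc _ ≤ _ := mul_le_mul (norm_aeval_le hR hcR z) ih (norm_nonneg _) (by positivity)
        _ = _ := by ring
  have hmahler : ‖p.leadingCoeff‖ * (t.map fun z => max 1 ‖z‖).prod ≤ (m + 1) * n := by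
    refine le_trans ?_ (mahlerMeasure_map_le hP hcP)
    rw [mahlerMeasure_eq_leadingCoeff_mul_prod_roots, ← hp, ht, Multiset.map_cons,
      Multiset.prod_cons]
    refine mul_le_mul_of_nonneg_left (le_mul_of_one_le_left ?_ (le_max_left _ _)) (norm_nonneg _)
    exact Multiset.prod_nonneg fun a ha => by
      obtain ⟨z, -, rfl⟩ := Multiset.mem_map.mp ha
      positivity
  have hprod0 : 0 ≤ (t.map fun z => max 1 ‖z‖).prod :=
    Multiset.prod_nonneg fun a ha => by
      obtain ⟨z, -, rfl⟩ := Multiset.mem_map.mp ha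
      positivity
  calc (1 : ℝ) ≤ ‖((resultant P R m m : ℤ) : ℂ)‖ := hone
    _ = ‖p.leadingCoeff‖ ^ m * (|aeval x R| * ‖(t.map fun z => aeval z R).prod‖) := by
        rw [hres, ht, Multiset.map_cons, Multiset.prod_cons, norm_mul, norm_mul, norm_pow, hxR]
    _ ≤ ‖p.leadingCoeff‖ ^ m * (|aeval x R| *
          (((m + 1) * h) ^ (m - 1) * (t.map fun z => max 1 ‖z‖).prod ^ m)) := by gcongr
    _ = |aeval x R| * ((m + 1) * h) ^ (m - 1) *
          (‖p.leadingCoeff‖ * (t.map fun z => max 1 ‖z‖).prod) ^ m := by ring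
    _ ≤ _ := by gcongr

lemma abs_pow_sub_pow_le_of_mem_Icc {x y : ℝ} (hx : x ∈ Set.Icc (0 : ℝ) (1 / 2))
    (hy : y ∈ Set.Icc (0 : ℝ) (1 / 2)) (i : ℕ) : |x ^ i - y ^ i| ≤ |x - y| := by
  induction i with
  | zero => simp
  | succ i ih =>
    rcases i with _ | i
    · simp
    · have hyi : y ^ (i + 1) ≤ 1 / 2 := by
        rw [pow_succ]
        have := pow_le_one₀ (n := i) hy.1 (hy.2.trans (by norm_num))
        nlinarith [hy.1, hy.2]
      have hyi0 : 0 ≤ y ^ (i + 1) := pow_nonneg hy.1 _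
      calc |x ^ (i + 1 + 1) - y ^ (i + 1 + 1)|
          = |x * (x ^ (i + 1) - y ^ (i + 1)) + (x - y) * y ^ (i + 1)| := by ring_nf
        _ ≤ x * |x ^ (i + 1) - y ^ (i + 1)| + |x - y| * y ^ (i + 1) := by
            refine (abs_add_le _ _).trans (le_of_eq ?_)
            rw [abs_mul, abs_mul, abs_of_nonneg hx.1, abs_of_nonneg hyi0]
        _ ≤ 1 / 2 * |x - y| + |x - y| * (1 / 2) := by
            gcongr
            exact hx.2
        _ = |x - y| := by ring

lemma abs_aeval_sub_aeval_le {R : ℤ[X]} {m : ℕ} {h x y : ℝ} (hR : R.natDegree ≤ m)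
    (hc : ∀ i, |(R.coeff i : ℝ)| ≤ h) (hx : x ∈ Set.Icc (0 : ℝ) (1 / 2))
    (hy : y ∈ Set.Icc (0 : ℝ) (1 / 2)) :
    |aeval x R - aeval y R| ≤ (m + 1) * h * |x - y| := by
  have h0 : 0 ≤ h := (abs_nonneg _).trans (hc 0)
  rw [aeval_eq_sum_range' (Nat.lt_succ_of_le hR), aeval_eq_sum_range' (Nat.lt_succ_of_le hR),
    ← Finset.sum_sub_distrib]
  calc _ ≤ ∑ i ∈ Finset.range (m + 1), h * |x - y| := by
        refine (Finset.abs_sum_le_sum_abs _ _).trans (Finset.sum_le_sum fun i _ => ?_)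
        rw [zsmul_eq_mul, zsmul_eq_mul, ← mul_sub, abs_mul]
        exact mul_le_mul (hc i) (abs_pow_sub_pow_le_of_mem_Icc hx hy i) (abs_nonneg _) h0
    _ = _ := by simp [mul_assoc]

/-- Separation of algebraic numbers of the same degree and bounded height in `[0, 1/2]`. -/
lemma one_le_abs_sub_mul {m n : ℕ} (hm : 1 ≤ m) {x y : ℝ} (hne : x ≠ y)
    (hx : DegreeExactly m x) (hy : DegreeExactly m y)
    (hxI : x ∈ Set.Icc (0 : ℝ) (1 / 2)) (hyI : y ∈ Set.Icc (0 : ℝ) (1 / 2))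
    (hHx : algHeight x ≤ n) (hHy : algHeight y ≤ n) :
    1 ≤ |x - y| * (((m + 1) * (m * n)) ^ m * ((m + 1) * n) ^ m) := by
  obtain ⟨hxa, hxm⟩ := hx
  obtain ⟨hya, hym⟩ := hy
  have hcoeff {α : ℝ} (hα : algHeight α ≤ n) (i : ℕ) : |((intMinpoly α).coeff i : ℝ)| ≤ n :=
    (abs_coeff_intMinpoly_le α i).trans (by exact_mod_cast hα)
  have hPdeg : (intMinpoly x).natDegree = m := (natDegree_intMinpoly hxa).trans hxm
  have hm1 : (1 : ℝ) ≤ m := by exact_mod_cast hm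
  have hn0 : (0 : ℝ) ≤ n := Nat.cast_nonneg n
  have key : ∃ (R : ℤ[X]) (ξ : ℝ), R.natDegree ≤ m ∧ (∀ i, |(R.coeff i : ℝ)| ≤ m * n) ∧
      (∀ z : ℂ, aeval z (intMinpoly x) = 0 → aeval z R ≠ 0) ∧ aeval ξ R = 0 ∧
      ξ ∈ Set.Icc (0 : ℝ) (1 / 2) ∧ |x - ξ| ≤ |x - y| := by
    by_cases hmin : minpoly ℚ x = minpoly ℚ y
    · have hPy : aeval y (intMinpoly x) = 0 := by
        rw [aeval_intMinpoly_eq_zero_iff hxa, hmin]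
        exact minpoly.aeval ℚ y
      have hPx := aeval_intMinpoly_self hxa
      obtain ⟨ξ, hξ, hξ0⟩ : ∃ ξ ∈ Set.uIcc x y, aeval ξ (derivative (intMinpoly x)) = 0 := by
        have rolle {a b : ℝ} (hab : a < b) (ha : aeval a (intMinpoly x) = 0)
            (hb : aeval b (intMinpoly x) = 0) :
            ∃ ξ ∈ Set.Icc a b, aeval ξ (derivative (intMinpoly x)) = 0 := by
          obtain ⟨ξ, hξ, h⟩ := exists_hasDerivAt_eq_zero hab
            (intMinpoly x).continuous_aeval.continuousOn (ha.trans hb.symm)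
            (fun t _ => (intMinpoly x).hasDerivAt_aeval t)
          exact ⟨ξ, Set.Ioo_subset_Icc_self hξ, h⟩
        rcases lt_or_gt_of_ne hne with hlt | hlt
        · rw [Set.uIcc_of_le hlt.le]
          exact rolle hlt hPx hPy
        · rw [Set.uIcc_of_ge hlt.le]
          exact rolle hlt hPy hPx
      refine ⟨derivative (intMinpoly x), ξ, ?_, fun i => ?_, fun z hz hz' => ?_, hξ0,
        Set.uIcc_subset_Icc hxI hyI hξ, by
          simpa only [abs_sub_comm] using Set.abs_sub_left_of_mem_uIcc hξ⟩
      · exact (natDegree_derivative_le _).trans (by omega)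
      · rcases lt_or_ge i m with hi | hi
        · rw [coeff_derivative]
          push_cast
          rw [abs_mul, mul_comm]
          have hi' : (i : ℝ) + 1 ≤ m := by exact_mod_cast hi
          rw [abs_of_nonneg (by positivity : (0 : ℝ) ≤ (i : ℝ) + 1)]
          exact mul_le_mul hi' (hcoeff hHx _) (abs_nonneg _) (by positivity)
        · rw [coeff_eq_zero_of_natDegree_lt]
          · simp only [Int.cast_zero, abs_zero]
            positivity
          · exact lt_of_lt_of_le (natDegree_derivative_lt (by omega)) (by omega)
      · have hdvd := minpoly_dvd_map_of_common_root hxa hz hz'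
        have hne0 : derivative (intMinpoly x) ≠ 0 := by
          intro h0
          have := derivative_eq_zero.mp h0
          omega
        have hle := natDegree_le_of_dvd hdvd
          ((Polynomial.map_ne_zero_iff (algebraMap ℤ ℚ).injective_int).mpr hne0)
        rw [natDegree_map_eq_of_injective (algebraMap ℤ ℚ).injective_int] at hle
        have := natDegree_derivative_lt (p := intMinpoly x) (by omega)
        omega
    · refine ⟨intMinpoly y, y, ((natDegree_intMinpoly hya).trans hym).le, fun i => ?_,
        fun z hz hz' => hmin ?_, aeval_intMinpoly_self hya, hyI, le_rfl⟩
      · exact (hcoeff hHy i).trans (le_mul_of_one_le_left hn0 hm1)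
      · have hdvd := minpoly_dvd_map_of_common_root hxa hz hz'
        obtain ⟨c, hc, h⟩ := intMinpoly_map hya
        rw [h, (isUnit_C.mpr hc.isUnit).dvd_mul_left] at hdvd
        exact eq_of_monic_of_associated (minpoly.monic hxa.isIntegral)
          (minpoly.monic hya.isIntegral)
          ((minpoly.irreducible hxa.isIntegral).associated_of_dvd
            (minpoly.irreducible hya.isIntegral) hdvd)
  obtain ⟨R, ξ, hRdeg, hRc, hRP, hξ0, hξI, hξ⟩ := key
  have hlow := one_le_abs_aeval_mul (intMinpoly_ne_zero hxa) hPdeg hRdeg (hcoeff hHx) hRc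
    (aeval_intMinpoly_self hxa) hRP
  have hup := abs_aeval_sub_aeval_le hRdeg hRc hxI hξI
  rw [hξ0, sub_zero] at hup
  calc (1 : ℝ) ≤ _ := hlow
    _ ≤ ((m + 1) * (m * n) * |x - y|) * ((m + 1) * (m * n)) ^ (m - 1) * ((m + 1) * n) ^ m := by
        gcongr
        exact hup.trans (by gcongr)
    _ = _ := by
        obtain ⟨k, rfl⟩ := Nat.exists_eq_add_of_le' hm
        rw [Nat.add_sub_cancel, pow_succ ((((k + 1 : ℕ) : ℝ) + 1) * (((k + 1 : ℕ) : ℝ) * n)) k]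
        ring

lemma one_le_two_mul_mul_of_pos {n : ℕ} {x : ℝ} (hx : IsAlgebraic ℚ x) (hpos : 0 < x)
    (hle : x ≤ 1 / 2) (hH : algHeight x ≤ n) : 1 ≤ 2 * n * x := by
  set P := intMinpoly x
  have hcoeff (i : ℕ) : |(P.coeff i : ℝ)| ≤ n :=
    (abs_coeff_intMinpoly_le x i).trans (by exact_mod_cast hH)
  have hP0 : P.coeff 0 ≠ 0 := by
    obtain ⟨c, hc, h⟩ := intMinpoly_map hx
    intro h0
    have h1 : ((P.map (algebraMap ℤ ℚ)).coeff 0) = 0 := by rw [coeff_map, h0, map_zero]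
    rw [h, coeff_C_mul] at h1
    exact mul_ne_zero hc (minpoly.coeff_zero_ne_zero hx.isIntegral hpos.ne') h1
  have hroot : aeval x P = 0 := aeval_intMinpoly_self hx
  rw [aeval_eq_sum_range, Finset.sum_range_succ'] at hroot
  have hone : (1 : ℝ) ≤ |(P.coeff 0 : ℝ)| := by exact_mod_cast Int.one_le_abs hP0
  have hgeom : ∑ i ∈ Finset.range P.natDegree, x ^ i ≤ 2 := by
    have hle' : ∑ i ∈ Finset.range P.natDegree, x ^ i ≤
        ∑ i ∈ Finset.range P.natDegree, (1 / 2 : ℝ) ^ i :=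
      Finset.sum_le_sum fun i _ => pow_le_pow_left₀ hpos.le hle i
    exact hle'.trans (sum_geometric_two_le _)
  have heq : (P.coeff 0 : ℝ) =
      -∑ i ∈ Finset.range P.natDegree, P.coeff (i + 1) • x ^ (i + 1) := by
    rw [pow_zero, zsmul_eq_mul, mul_one] at hroot
    linarith
  calc (1 : ℝ) ≤ |(P.coeff 0 : ℝ)| := hone
    _ ≤ ∑ i ∈ Finset.range P.natDegree, n * x * x ^ i := by
        rw [heq, abs_neg]
        refine (Finset.abs_sum_le_sum_abs _ _).trans (Finset.sum_le_sum fun i _ => ?_)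
        rw [zsmul_eq_mul, abs_mul, abs_of_nonneg (pow_nonneg hpos.le _), pow_succ']
        calc _ ≤ (n : ℝ) * (x * x ^ i) := by
              gcongr
              exact hcoeff _
          _ = _ := by ring
    _ = n * x * ∑ i ∈ Finset.range P.natDegree, x ^ i := by rw [Finset.mul_sum]
    _ ≤ n * x * 2 := by gcongr
    _ = _ := by ring

lemma two_mul_mul_abs_sub_le_abs_cos_sub_cos {x y : ℝ} (hx : x ∈ Set.Icc (0 : ℝ) (1 / 2))
    (hy : y ∈ Set.Icc (0 : ℝ) (1 / 2)) :
    2 * (x + y) * |x - y| ≤ |Real.cos (Real.pi * x) - Real.cos (Real.pi * y)| := by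
  obtain ⟨hx0, hx1⟩ := hx
  obtain ⟨hy0, hy1⟩ := hy
  have hsin {t : ℝ} (h0 : 0 ≤ t) (h1 : t ≤ 1) : t ≤ Real.sin (Real.pi * t / 2) := by
    have hpi := Real.pi_pos
    have := Real.mul_le_sin (x := Real.pi * t / 2) (by positivity) (by nlinarith)
    calc t = 2 / Real.pi * (Real.pi * t / 2) := by field_simp
      _ ≤ _ := this
  have habs : |Real.sin ((Real.pi * x - Real.pi * y) / 2)| =
      |Real.sin (Real.pi * |x - y| / 2)| := by
    rcases abs_cases (x - y) with ⟨h, -⟩ | ⟨h, -⟩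
    · rw [h, mul_sub]
    · rw [h, ← abs_neg, ← Real.sin_neg]
      ring_nf
  rw [Real.cos_sub_cos, abs_mul, abs_mul, abs_neg, habs, ← mul_add, Nat.abs_ofNat]
  have h1 := (hsin (t := x + y) (by linarith) (by linarith)).trans (le_abs_self _)
  have h2 := (hsin (t := |x - y|) (abs_nonneg _) (abs_le.mpr ⟨by linarith, by linarith⟩)).trans
    (le_abs_self _)
  gcongr

lemma separation_constant_le {m : ℕ} (hm : 1 ≤ m) (n : ℕ) :
    (((m : ℝ) + 1) * (m * n)) ^ m * ((m + 1) * n) ^ m ≤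
      2 ^ (4 * m ^ 2 - 1) * (n : ℝ) ^ (2 * m) := by
  have h1 : (m : ℝ) + 1 ≤ 2 ^ m := by exact_mod_cast Nat.lt_two_pow_self
  have h2 : (m : ℝ) ≤ 2 ^ (m - 1) := by
    obtain ⟨k, rfl⟩ := Nat.exists_eq_add_of_le' hm
    exact_mod_cast Nat.lt_two_pow_self
  calc (((m : ℝ) + 1) * (m * n)) ^ m * ((m + 1) * n) ^ m
      ≤ ((2 ^ m) * (2 ^ (m - 1) * n)) ^ m * (2 ^ m * n) ^ m := by gcongr
    _ = 2 ^ (m * m + (m - 1) * m + m * m) * (n : ℝ) ^ (2 * m) := by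
        simp only [mul_pow, pow_add, ← pow_mul, two_mul]
        ring
    _ ≤ _ := by
        gcongr
        · norm_num
        · obtain ⟨k, rfl⟩ := Nat.exists_eq_add_of_le' hm
          refine Nat.le_sub_one_of_lt ?_
          rw [Nat.add_sub_cancel]
          nlinarith

/-- If `x ≠ y` are real algebraic numbers of degree exactly `m` in `[0, 1/2]` with
heights at most `n`, then `|cos (πx) - cos (πy)| ≥ π / (2^(4m²+1) n^(2m+1))`. -/
theorem stmt_11 (m n : ℕ) (hm : 1 ≤ m) (hn : 1 ≤ n) (x y : ℝ) (hne : x ≠ y)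
    (hx : DegreeExactly m x) (hy : DegreeExactly m y)
    (hxI : x ∈ Set.Icc (0 : ℝ) (1 / 2)) (hyI : y ∈ Set.Icc (0 : ℝ) (1 / 2))
    (hHx : algHeight x ≤ n) (hHy : algHeight y ≤ n) :
    |Real.cos (Real.pi * x) - Real.cos (Real.pi * y)| ≥
      Real.pi / (2 ^ (4 * m ^ 2 + 1) * (n : ℝ) ^ (2 * m + 1)) := by
  wlog hyx : y < x generalizing x y
  · rw [abs_sub_comm]
    exact this y x hne.symm hy hx hyI hxI hHy hHx (lt_of_le_of_ne (not_lt.mp hyx) hne)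
  have hn0 : (0 : ℝ) < n := by exact_mod_cast hn
  have hxpos : 0 < x := hyI.1.trans_lt hyx
  have hsep := (one_le_abs_sub_mul hm hne hx hy hxI hyI hHx hHy).trans
    (mul_le_mul_of_nonneg_left (separation_constant_le hm n) (abs_nonneg _))
  have hlow := one_le_two_mul_mul_of_pos hx.1 hxpos hxI.2 hHx
  refine ge_iff_le.mpr (le_trans ?_ (two_mul_mul_abs_sub_le_abs_cos_sub_cos hxI hyI))
  rw [div_le_iff₀ (by positivity)]
  have hpow : (2 : ℝ) ^ (4 * m ^ 2 + 1) = 4 * 2 ^ (4 * m ^ 2 - 1) := by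
    have : 4 * m ^ 2 + 1 = (4 * m ^ 2 - 1) + 2 := by
      have := Nat.one_le_pow 2 m hm
      omega
    rw [this, pow_add]
    ring
  have hxy : 1 ≤ 2 * n * (x + y) := hlow.trans (by gcongr; linarith [hyI.1])
  calc Real.pi ≤ 4 * (1 * 1) := by linarith [Real.pi_le_four]
    _ ≤ 4 * ((2 * n * (x + y)) * (|x - y| * (2 ^ (4 * m ^ 2 - 1) * (n : ℝ) ^ (2 * m)))) := by
        gcongr
    _ = 2 * (x + y) * |x - y| * (2 ^ (4 * m ^ 2 + 1) * (n : ℝ) ^ (2 * m + 1)) := by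
        rw [hpow]
        ring
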